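/- Let V, W : ℝⁿ → ℝ be twice continuously differentiable functions with ∫ e^{−V(x)} dx = ∫ e^{−W(x)} dx = 1, and suppose D²V(x) ≤ C·Id and D²W(x) ≥ c·Id for all x, where 0 < c and 0 < C. Let Φ : ℝⁿ → ℝ be a convex differentiable function such that the pushforward of the measure e^{−V} dx under ∇Φ equals the measure e^{−W} dx and the coupling (id, ∇Φ)_*(e^{−V} dx) minimizes ∫ ‖x − y‖² dπ over all couplings of e^{−V} dx and e^{−W} dx. Then ∇Φ is √(C/c)-Lipschitz: ‖∇Φ(x) − ∇Φ(y)‖ ≤ √(C/c) ‖x − y‖ for all x, y ∈ ℝⁿ. -/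

import Mathlib

open MeasureTheory ENNReal
open scoped RealInnerProductSpace

noncomputable section

/-- `π` is a coupling of `μ` and `ν`. -/
def IsCoupling {α β : Type*} [MeasurableSpace α] [MeasurableSpace β]
    (μ : Measure α) (ν : Measure β) (π : Measure (α × β)) : Prop :=
  π.map Prod.fst = μ ∧ π.map Prod.snd = ν

section Auxiliary

open Set Filter Topology

section ConvexGradient

variable {E : Type*} [NormedAddCommGroup E] [InnerProductSpace ℝ E] [CompleteSpace E]
  {Φ : E → ℝ}

/-- The gradient inequality for differentiable convex functions. -/
lemma ConvexOn.add_inner_gradient_le (hconv : ConvexOn ℝ univ Φ) (hdiff : Differentiable ℝ Φ)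
    (x y : E) : Φ x + ⟪gradient Φ x, y - x⟫ ≤ Φ y := by
  have hg : ConvexOn ℝ univ (fun s : ℝ => Φ (AffineMap.lineMap x y s)) := by
    exact hconv.comp_affineMap (AffineMap.lineMap x y : ℝ →ᵃ[ℝ] E)
  have hd : HasDerivAt (fun s : ℝ => Φ (AffineMap.lineMap x y s)) ⟪gradient Φ x, y - x⟫ 0 := by
    have h1 : HasDerivAt (AffineMap.lineMap x y : ℝ → E) (y - x) 0 := AffineMap.hasDerivAt_lineMap
    have h2 : HasFDerivAt Φ (fderiv ℝ Φ x) (AffineMap.lineMap x y (0 : ℝ)) := by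
      simpa using (hdiff x).hasFDerivAt
    rw [inner_gradient_left]
    exact h2.comp_hasDerivAt (0 : ℝ) h1
  have := hg.le_slope_of_hasDerivAt (mem_univ 0) (mem_univ 1) one_pos hd
  rw [slope_def_field] at this
  simp only [AffineMap.lineMap_apply_one, AffineMap.lineMap_apply_zero, sub_zero, div_one] at this
  linarith

lemma ConvexOn.inner_gradient_sub_nonneg (hconv : ConvexOn ℝ univ Φ) (hdiff : Differentiable ℝ Φ)
    (x y : E) : 0 ≤ ⟪gradient Φ x - gradient Φ y, x - y⟫ := by
  have h1 := hconv.add_inner_gradient_le hdiff x y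
  have h2 := hconv.add_inner_gradient_le hdiff y x
  have h3 : ⟪gradient Φ x, y - x⟫ = - ⟪gradient Φ x, x - y⟫ := by
    rw [← inner_neg_right, neg_sub]
  rw [inner_sub_left]
  linarith

/-- A differentiable convex function is continuously differentiable. -/
lemma ConvexOn.continuous_gradient (hconv : ConvexOn ℝ univ Φ) (hdiff : Differentiable ℝ Φ) :
    Continuous (gradient Φ) := by
  rw [continuous_iff_continuousAt]
  intro x₀
  rw [Metric.continuousAt_iff]
  intro ε hε
  have hlo := (hasGradientAt_iff_isLittleO.1 (hdiff x₀).hasGradientAt).def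
    (show 0 < ε / 4 by positivity)
  obtain ⟨r, hr, hball⟩ := Metric.eventually_nhds_iff.1 hlo
  set s := r / 2 with hs
  have hs0 : 0 < s := by positivity
  refine ⟨s / 2, by positivity, fun x hx => ?_⟩
  rw [dist_eq_norm] at hx ⊢
  set q := gradient Φ x - gradient Φ x₀ with hq
  by_cases hq0 : q = 0
  · simpa [hq0] using hε
  have hqn : 0 < ‖q‖ := norm_pos_iff.2 hq0
  set e := (s / ‖q‖) • q with he
  have hen : ‖e‖ = s := by
    rw [he, norm_smul, Real.norm_of_nonneg (by positivity)]; field_simp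
  have hqe : ⟪q, e⟫ = s * ‖q‖ := by
    rw [he, inner_smul_right, real_inner_self_eq_norm_sq]; field_simp
  have h1 := hball (y := x₀ + e) (by simp [hen, hs]; linarith)
  simp only [add_sub_cancel_left, hen] at h1
  have h1' := (abs_le.1 (Real.norm_eq_abs _ ▸ h1)).2
  have h2 := hconv.add_inner_gradient_le hdiff x (x₀ + e)
  have h3 := hconv.add_inner_gradient_le hdiff x₀ x
  have h4 : x₀ + e - x = e - (x - x₀) := by abel
  have h5 : ⟪q, x - x₀⟫ ≤ ‖q‖ * ‖x - x₀‖ := real_inner_le_norm _ _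
  rw [h4, inner_sub_right] at h2
  have h6 : ⟪gradient Φ x, e⟫ = ⟪gradient Φ x₀, e⟫ + s * ‖q‖ := by
    rw [← hqe, hq, inner_sub_left]; ring
  have h7 : ⟪gradient Φ x, x - x₀⟫ = ⟪gradient Φ x₀, x - x₀⟫ + ⟪q, x - x₀⟫ := by
    rw [hq, inner_sub_left]; ring
  have h8 : ‖q‖ * ‖x - x₀‖ ≤ ‖q‖ * (s / 2) := by gcongr
  have h9 : s * ‖q‖ ≤ s * (ε / 2) := by linarith
  have := le_of_mul_le_mul_left h9 hs0
  linarith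

/-- The derivative of a gradient is symmetric. -/
lemma isSymmetric_fderiv_gradient (hdiff : Differentiable ℝ Φ) {x : E}
    (hx : DifferentiableAt ℝ (gradient Φ) x) :
    (fderiv ℝ (gradient Φ) x : E →ₗ[ℝ] E).IsSymmetric := by
  intro v w
  set L : E →L[ℝ] StrongDual ℝ E :=
    LinearMap.mkContinuous₂ (innerₗ E) 1 (by simpa using norm_inner_le_norm (𝕜 := ℝ) (E := E))
  have hL (v w : E) : L v w = ⟪v, w⟫ := rfl
  have h := second_derivative_symmetric_of_eventually_of_real (f := Φ)
    (f' := fun y => L (gradient Φ y)) (x := x)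
    (f'' := L ∘L fderiv ℝ (gradient Φ) x)
    (Eventually.of_forall fun y => by
      convert! (hdiff y).hasFDerivAt using 1
      ext v
      rw [hL, inner_gradient_left])
    (L.hasFDerivAt.comp x hx.hasFDerivAt) v w
  have h' : ⟪fderiv ℝ (gradient Φ) x v, w⟫ = ⟪fderiv ℝ (gradient Φ) x w, v⟫ := h
  simpa [real_inner_comm] using h'

lemma ConvexOn.inner_fderiv_gradient_nonneg (hconv : ConvexOn ℝ univ Φ)
    (hdiff : Differentiable ℝ Φ) {x : E} (hx : DifferentiableAt ℝ (gradient Φ) x) (v : E) :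
    0 ≤ ⟪fderiv ℝ (gradient Φ) x v, v⟫ := by
  have h1 : HasDerivAt (fun s : ℝ => gradient Φ (x + s • v)) (fderiv ℝ (gradient Φ) x v) 0 := by
    have h2 : HasDerivAt (fun s : ℝ => x + s • v) v 0 := by
      simpa using ((hasDerivAt_id (0 : ℝ)).smul_const v).const_add x
    have h3 : HasFDerivAt (gradient Φ) (fderiv ℝ (gradient Φ) x) (x + (0 : ℝ) • v) := by
      simpa using hx.hasFDerivAt
    exact h3.comp_hasDerivAt (0 : ℝ) h2
  have h4 : HasDerivAt (fun s : ℝ => ⟪gradient Φ (x + s • v), v⟫)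
      ⟪fderiv ℝ (gradient Φ) x v, v⟫ 0 := by
    simpa using h1.inner ℝ (hasDerivAt_const (0 : ℝ) v)
  have hm : Monotone (fun s : ℝ => ⟪gradient Φ (x + s • v), v⟫) := by
    intro a b hab
    rcases hab.eq_or_lt with rfl | hab
    · rfl
    have h5 := hconv.inner_gradient_sub_nonneg hdiff (x + b • v) (x + a • v)
    rw [show x + b • v - (x + a • v) = (b - a) • v by rw [sub_smul]; abel, inner_smul_right] at h5
    have h6 := nonneg_of_mul_nonneg_right h5 (sub_pos.2 hab)
    rw [inner_sub_left] at h6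
    dsimp only
    linarith
  rw [← h4.deriv]
  exact hm.deriv_nonneg

/-- A value of the gradient taken at two points is taken along the whole segment, so that the
Hessian degenerates there. -/
lemma ConvexOn.injOn_gradient (hconv : ConvexOn ℝ univ Φ) (hdiff : Differentiable ℝ Φ)
    [FiniteDimensional ℝ E] :
    InjOn (gradient Φ)
      {x | DifferentiableAt ℝ (gradient Φ) x ∧ (fderiv ℝ (gradient Φ) x).det ≠ 0} := by
  rintro x ⟨hx, hdet⟩ x' - heq
  by_contra hne
  have hseg : ∀ s ∈ Ioo (0 : ℝ) 1, gradient Φ (x + s • (x' - x)) = gradient Φ x := by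
    rintro s ⟨hs0, hs1⟩
    set z := x + s • (x' - x) with hz
    set p := gradient Φ x with hp
    have hmin : ∀ y, Φ z - ⟪p, z⟫ ≤ Φ y - ⟪p, y⟫ := by
      intro y
      have h1 := hconv.add_inner_gradient_le hdiff x y
      have h2 := hconv.add_inner_gradient_le hdiff x' x
      have h3 := hconv.2 (mem_univ x) (mem_univ x') (sub_nonneg.2 hs1.le) hs0.le (by ring)
      have h4 : (1 - s) • x + s • x' = z := by rw [hz, smul_sub, sub_smul, one_smul]; abel
      rw [h4, smul_eq_mul, smul_eq_mul] at h3
      have h5 : ⟪p, z⟫ = (1 - s) * ⟪p, x⟫ + s * ⟪p, x'⟫ := by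
        rw [← h4, inner_add_right, inner_smul_right, inner_smul_right]
      rw [← heq, inner_sub_right] at h2
      rw [inner_sub_right, ← hp] at h1
      have h6 : s * (Φ x' - ⟪p, x'⟫) ≤ s * (Φ x - ⟪p, x⟫) :=
        mul_le_mul_of_nonneg_left (by linarith) hs0.le
      rw [h5]
      linarith
    have hloc : IsLocalMin (fun y => Φ y - ⟪p, y⟫) z := Eventually.of_forall hmin
    have hder : HasFDerivAt (fun y => Φ y - ⟪p, y⟫) (fderiv ℝ Φ z - innerSL ℝ p) z :=
      (hdiff z).hasFDerivAt.sub (innerSL ℝ p).hasFDerivAt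
    have h0 := hloc.hasFDerivAt_eq_zero hder
    refine ext_inner_right ℝ fun v => ?_
    have := congrArg (fun l => l v) h0
    simp only [sub_apply, innerSL_apply_apply,
      zero_apply] at this
    rw [inner_gradient_left]
    linarith
  have h1 : HasDerivWithinAt (fun s : ℝ => gradient Φ (x + s • (x' - x)))
      (fderiv ℝ (gradient Φ) x (x' - x)) (Ioi 0) 0 := by
    have h2 : HasDerivAt (fun s : ℝ => x + s • (x' - x)) (x' - x) 0 := by
      simpa using ((hasDerivAt_id (0 : ℝ)).smul_const (x' - x)).const_add x
    have h3 : HasFDerivAt (gradient Φ) (fderiv ℝ (gradient Φ) x) (x + (0 : ℝ) • (x' - x)) := by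
      simpa using hx.hasFDerivAt
    exact (h3.comp_hasDerivAt (0 : ℝ) h2).hasDerivWithinAt
  have h2 : HasDerivWithinAt (fun s : ℝ => gradient Φ (x + s • (x' - x))) 0 (Ioi 0) 0 := by
    refine (hasDerivWithinAt_const (0 : ℝ) (Ioi 0) (gradient Φ x)).congr_of_eventuallyEq ?_ (by simp)
    filter_upwards [Ioo_mem_nhdsGT (zero_lt_one (α := ℝ))] with s hs using hseg s hs
  have h3 : fderiv ℝ (gradient Φ) x (x' - x) = 0 := (uniqueDiffWithinAt_Ioi 0).eq_deriv _ h1 h2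
  have h4 : Function.Injective (fderiv ℝ (gradient Φ) x) :=
    ((fderiv ℝ (gradient Φ) x).toContinuousLinearEquivOfDetNeZero hdet).injective
  exact hne (sub_eq_zero.1 (h4 (h3.trans (map_zero _).symm))).symm

end ConvexGradient

section Alexandrov

variable {E : Type*} [NormedAddCommGroup E] [InnerProductSpace ℝ E] [CompleteSpace E]
  [FiniteDimensional ℝ E] {Φ : E → ℝ}

/-- For a convex differentiable `Φ` on a finite-dimensional space, `id + ∇Φ` is onto. -/
lemma ConvexOn.exists_add_gradient_eq (hconv : ConvexOn ℝ univ Φ) (hdiff : Differentiable ℝ Φ)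
    (z : E) : ∃ x, x + gradient Φ x = z := by
  have hsq (x : E) : HasFDerivAt (fun x : E => ‖x‖ ^ 2) (2 • innerSL ℝ x) x :=
    (hasStrictFDerivAt_norm_sq x).hasFDerivAt
  set ψ : E → ℝ := fun x => Φ x + (1 / 2 : ℝ) * ‖x‖ ^ 2 - ⟪z, x⟫ with hψ
  have hcont : Continuous ψ := by
    have := hdiff.continuous
    fun_prop
  have hlim : Tendsto ψ (cocompact E) atTop := by
    have hlo : ∀ x, Φ 0 + ‖x‖ * ((1 / 2 : ℝ) * ‖x‖ - (‖gradient Φ 0‖ + ‖z‖)) ≤ ψ x := by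
      intro x
      have h1 := hconv.add_inner_gradient_le hdiff 0 x
      have h2 := (abs_le.1 (abs_real_inner_le_norm (gradient Φ 0) x)).1
      have h3 := real_inner_le_norm z x
      rw [sub_zero] at h1
      simp only [hψ]
      nlinarith
    refine tendsto_atTop_mono hlo (tendsto_atTop_add_const_left _ _ ?_)
    refine (tendsto_norm_cocompact_atTop (E := E)).atTop_mul_atTop₀ ?_
    exact tendsto_atTop_add_const_right _ _
      ((tendsto_norm_cocompact_atTop (E := E)).const_mul_atTop (by norm_num))
  obtain ⟨x, hx⟩ := hcont.exists_forall_le hlim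
  have hder : HasFDerivAt ψ (fderiv ℝ Φ x + (1 / 2 : ℝ) • (2 • innerSL ℝ x) - innerSL ℝ z) x :=
    ((hdiff x).hasFDerivAt.add ((hsq x).const_mul _)).sub (innerSL ℝ z).hasFDerivAt
  have h0 := IsLocalMin.hasFDerivAt_eq_zero (Eventually.of_forall hx) hder
  refine ⟨x, ext_inner_right ℝ fun v => ?_⟩
  have := congrArg (fun l => l v) h0
  simp at this
  rw [inner_add_left, inner_gradient_left]
  linarith

variable [MeasurableSpace E] [BorelSpace E] (μ : Measure E) [μ.IsAddHaarMeasure]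

/-- **Alexandrov's theorem** for differentiable convex functions. -/
theorem ConvexOn.ae_differentiableAt_gradient (hconv : ConvexOn ℝ univ Φ)
    (hdiff : Differentiable ℝ Φ) : ∀ᵐ x ∂μ, DifferentiableAt ℝ (gradient Φ) x := by
  choose R hR using hconv.exists_add_gradient_eq hdiff
  have hmono (z w : E) : ‖R z - R w‖ ^ 2 ≤ ⟪z - w, R z - R w⟫ := by
    have h1 := hconv.inner_gradient_sub_nonneg hdiff (R z) (R w)
    have h2 : z - w = (R z - R w) + (gradient Φ (R z) - gradient Φ (R w)) := by
      rw [sub_add_sub_comm, hR, hR]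
    rw [h2, inner_add_left, real_inner_self_eq_norm_sq]
    linarith
  have hlip : LipschitzWith 1 R := LipschitzWith.of_dist_le_mul fun z w => by
    have h1 := (hmono z w).trans (real_inner_le_norm _ _)
    rw [dist_eq_norm, dist_eq_norm, NNReal.coe_one, one_mul]
    by_contra! h
    nlinarith [norm_nonneg (z - w)]
  have hinv (x : E) : R (x + gradient Φ x) = x := by
    have h1 := hconv.inner_gradient_sub_nonneg hdiff (R (x + gradient Φ x)) x
    have h2 := hR (x + gradient Φ x)
    have h3 : gradient Φ (R (x + gradient Φ x)) - gradient Φ x = - (R (x + gradient Φ x) - x) := by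
      rw [eq_sub_of_add_eq' h2]; abel
    rw [h3, inner_neg_left, real_inner_self_eq_norm_sq] at h1
    have h4 : ‖R (x + gradient Φ x) - x‖ = 0 := by
      nlinarith [sq_nonneg ‖R (x + gradient Φ x) - x‖]
    exact sub_eq_zero.1 (norm_eq_zero.1 h4)
  have hcont : Continuous fun x => x + gradient Φ x :=
    continuous_id.add (hconv.continuous_gradient hdiff)
  set N := {z | ¬ DifferentiableAt ℝ R z}
  set Z := {z | DifferentiableAt ℝ R z ∧ (fderiv ℝ R z).det = 0}
  have hN : μ (R '' N) = 0 := by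
    have h0 : μ N = 0 := hlip.ae_differentiableAt
    have h1 : μH[Module.finrank ℝ E] N = 0 :=
      Measure.absolutelyContinuous_isAddHaarMeasure μH[Module.finrank ℝ E] μ h0
    have h2 := hlip.hausdorffMeasure_image_le (Nat.cast_nonneg (Module.finrank ℝ E)) N
    rw [h1, mul_zero, nonpos_iff_eq_zero] at h2
    exact Measure.absolutelyContinuous_isAddHaarMeasure μ μH[Module.finrank ℝ E] h2
  have hZ : μ (R '' Z) = 0 :=
    addHaar_image_eq_zero_of_det_fderivWithin_eq_zero μ
      (fun z hz => hz.1.hasFDerivAt.hasFDerivWithinAt) fun z hz => hz.2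
  filter_upwards [measure_eq_zero_iff_ae_notMem.1 hN, measure_eq_zero_iff_ae_notMem.1 hZ]
    with x hxN hxZ
  have hd : DifferentiableAt ℝ R (x + gradient Φ x) := by
    by_contra h
    exact hxN ⟨_, h, hinv x⟩
  have hdet : (fderiv ℝ R (x + gradient Φ x)).det ≠ 0 := fun h => hxZ ⟨_, ⟨hd, h⟩, hinv x⟩
  have hder := HasFDerivAt.of_local_left_inverse (f := R) (g := fun x => x + gradient Φ x) (a := x)
    (f' := (fderiv ℝ R (x + gradient Φ x)).toContinuousLinearEquivOfDetNeZero hdet)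
    hcont.continuousAt (by simpa using hd.hasFDerivAt) (Eventually.of_forall hinv)
  have : DifferentiableAt ℝ (fun y => (y + gradient Φ y) - y) x :=
    hder.differentiableAt.sub differentiableAt_id
  simpa using this

end Alexandrov

section Determinant

open Matrix MatrixOrder in
lemma Matrix.PosDef.four_pow_mul_det_mul_det_le {ι : Type*} [Fintype ι] [DecidableEq ι]
    {A B : Matrix ι ι ℝ} (hA : A.PosDef) (hB : B.PosDef) :
    4 ^ Fintype.card ι * (A.det * B.det) ≤ (A + B).det ^ 2 := by
  obtain ⟨S, hS, rfl⟩ : ∃ S : Matrix ι ι ℝ, IsUnit S ∧ A = Sᴴ * S := by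
    obtain ⟨S, rfl⟩ := CStarAlgebra.nonneg_iff_eq_star_mul_self.mp hA.posSemidef.nonneg
    refine ⟨S, ?_, rfl⟩
    have h := hA.det_pos
    rw [star_eq_conjTranspose, det_mul] at h
    exact (Matrix.isUnit_iff_isUnit_det S).2 (isUnit_iff_ne_zero.2 (right_ne_zero_of_mul h.ne'))
  have hSd : IsUnit S.det := (Matrix.isUnit_iff_isUnit_det S).1 hS
  have hSd' : IsUnit Sᴴ.det := by rw [det_conjTranspose]; exact hSd.star
  set M : Matrix ι ι ℝ := (S⁻¹)ᴴ * B * S⁻¹ with hM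
  have hMps : M.PosSemidef := hB.posSemidef.conjTranspose_mul_mul_same S⁻¹
  have hBM : B = Sᴴ * M * S := by
    rw [hM, conjTranspose_nonsing_inv]
    simp only [← Matrix.mul_assoc]
    rw [mul_nonsing_inv _ hSd', Matrix.one_mul, Matrix.mul_assoc, nonsing_inv_mul _ hSd,
      Matrix.mul_one]
  have hsum : (1 + M).det = ∏ i, (1 + hMps.1.eigenvalues i) := by
    have h1 := congrArg (Polynomial.eval (-1)) hMps.1.charpoly_eq
    rw [Matrix.eval_charpoly, Polynomial.eval_prod] at h1
    have h2 : scalar ι (-1 : ℝ) - M = -(1 + M) := by rw [map_neg, map_one, neg_add']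
    rw [h2, det_neg] at h1
    simp only [Polynomial.eval_sub, Polynomial.eval_X, Polynomial.eval_C] at h1
    have h3 : ∏ i, (-1 - (hMps.1.eigenvalues i : ℝ)) =
        (-1) ^ Fintype.card ι * ∏ i, (1 + hMps.1.eigenvalues i) := by
      rw [Fintype.card, ← Finset.prod_const, ← Finset.prod_mul_distrib]
      exact Finset.prod_congr rfl fun i _ => by ring
    have h4 : (-1 : ℝ) ^ Fintype.card ι ≠ 0 := by simp
    exact mul_left_cancel₀ h4 (h1.trans h3)
  have hdet : M.det = ∏ i, hMps.1.eigenvalues i := by simpa using hMps.1.det_eq_prod_eigenvalues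
  have hkey : 4 ^ Fintype.card ι * M.det ≤ (1 + M).det ^ 2 := by
    rw [hsum, hdet, Fintype.card, ← Finset.prod_const, ← Finset.prod_mul_distrib,
      ← Finset.prod_pow]
    refine Finset.prod_le_prod (fun i _ => ?_) fun i _ => ?_
    · have := hMps.eigenvalues_nonneg i
      positivity
    · nlinarith [sq_nonneg (1 - hMps.1.eigenvalues i)]
  have h1 : (Sᴴ * S + B).det = S.det ^ 2 * (1 + M).det := by
    have : Sᴴ * S + B = Sᴴ * (1 + M) * S := by
      rw [hBM, Matrix.mul_add, Matrix.add_mul, Matrix.mul_one]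
    rw [this, det_mul, det_mul, det_conjTranspose]
    simp only [star_trivial]; ring
  have h2 : (Sᴴ * S).det * B.det = (S.det ^ 2) ^ 2 * M.det := by
    rw [hBM, det_mul, det_mul, det_mul, det_conjTranspose]
    simp only [star_trivial]; ring
  rw [h1, h2, mul_pow]
  nlinarith [sq_nonneg (S.det ^ 2)]

/-- Log-concavity of the determinant at the midpoint, for symmetric nonnegative operators. -/
lemma ContinuousLinearMap.det_mul_det_le_det_midpoint_sq {E : Type*} [NormedAddCommGroup E]
    [InnerProductSpace ℝ E] [FiniteDimensional ℝ E] {A B : E →L[ℝ] E}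
    (hAs : (A : E →ₗ[ℝ] E).IsSymmetric) (hBs : (B : E →ₗ[ℝ] E).IsSymmetric)
    (hA : ∀ v, 0 ≤ ⟪A v, v⟫) (hB : ∀ v, 0 ≤ ⟪B v, v⟫) (hA0 : A.det ≠ 0) (hB0 : B.det ≠ 0) :
    0 < A.det ∧ 0 < B.det ∧ A.det * B.det ≤ ((1 / 2 : ℝ) • (A + B)).det ^ 2 := by
  set b := stdOrthonormalBasis ℝ E
  have hdet (T : E →L[ℝ] E) : T.det = (LinearMap.toMatrix b.toBasis b.toBasis (T : E →ₗ[ℝ] E)).det :=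
    (LinearMap.det_toMatrix b.toBasis (T : E →ₗ[ℝ] E)).symm
  have hpd (T : E →L[ℝ] E) (hTs : (T : E →ₗ[ℝ] E).IsSymmetric) (hT : ∀ v, 0 ≤ ⟪T v, v⟫)
      (hT0 : T.det ≠ 0) : (LinearMap.toMatrix b.toBasis b.toBasis (T : E →ₗ[ℝ] E)).PosDef := by
    have hps : (LinearMap.toMatrix b.toBasis b.toBasis (T : E →ₗ[ℝ] E)).PosSemidef := by
      rw [LinearMap.posSemidef_toMatrix_iff]
      exact ⟨hTs, fun v => by simpa using hT v⟩
    rw [hdet] at hT0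
    exact hps.posDef_iff_det_ne_zero.2 hT0
  have hpA := hpd A hAs hA hA0
  have hpB := hpd B hBs hB hB0
  have := hpA.four_pow_mul_det_mul_det_le hpB
  refine ⟨hdet A ▸ hpA.det_pos, hdet B ▸ hpB.det_pos, ?_⟩
  rw [hdet A, hdet B, hdet]
  simp only [ContinuousLinearMap.toLinearMap_smul, ContinuousLinearMap.toLinearMap_add, map_smul, map_add,
    Matrix.det_smul]
  rw [mul_pow, ← pow_mul, mul_comm _ 2, pow_mul]
  have h4 : ((1 / 2 : ℝ) ^ 2) ^ Fintype.card (Fin (Module.finrank ℝ E)) *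
    4 ^ Fintype.card (Fin (Module.finrank ℝ E)) = 1 := by rw [← mul_pow]; norm_num
  refine le_trans (le_of_eq ?_) (mul_le_mul_of_nonneg_left this (by positivity))
  rw [← mul_assoc, h4, one_mul]

end Determinant

section Translates

variable {E : Type*} [NormedAddCommGroup E] [InnerProductSpace ℝ E] {Φ : E → ℝ}

lemma ConvexOn.midpoint_translates (hconv : ConvexOn ℝ univ Φ) (t : E) :
    ConvexOn ℝ univ fun x => (1 / 2 : ℝ) * (Φ (x + t) + Φ (x - t)) := by
  have h1 : ConvexOn ℝ univ fun x => Φ (x + t) := by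
    simpa [Function.comp_def] using hconv.translate_left t
  have h2 : ConvexOn ℝ univ fun x => Φ (x - t) := by
    simpa [Function.comp_def, sub_eq_add_neg] using hconv.translate_left (-t)
  simpa using (h1.add h2).smul (show (0 : ℝ) ≤ 1 / 2 by norm_num)

variable [CompleteSpace E]

lemma hasGradientAt_midpoint_translates (hdiff : Differentiable ℝ Φ) (t x : E) :
    HasGradientAt (fun x => (1 / 2 : ℝ) * (Φ (x + t) + Φ (x - t)))
      ((1 / 2 : ℝ) • (gradient Φ (x + t) + gradient Φ (x - t))) x := by
  have h1 : HasFDerivAt (fun x => Φ (x + t)) (fderiv ℝ Φ (x + t)) x :=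
    (hasFDerivAt_comp_add_right t).2 (hdiff (x + t)).hasFDerivAt
  have h2 : HasFDerivAt (fun x => Φ (x - t)) (fderiv ℝ Φ (x - t)) x :=
    (hasFDerivAt_comp_sub t).2 (hdiff (x - t)).hasFDerivAt
  rw [hasGradientAt_iff_hasFDerivAt]
  convert! (h1.add h2).const_mul (1 / 2 : ℝ) using 1
  simp [toDual_gradient]

/-- Where a convex function `F` exceeds a convex function `G`, the gradient of `F` only takes
values that `∇G` takes in the same region. -/
lemma gradient_preimage_image_subset {F G : E → ℝ} (hF : ConvexOn ℝ univ F)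
    (hFd : Differentiable ℝ F) (hG : ConvexOn ℝ univ G) (hGd : Differentiable ℝ G) :
    gradient G ⁻¹' (gradient F '' {x | G x < F x}) ⊆ {x | G x < F x} := by
  rintro x' ⟨x, hx, hxx'⟩
  by_contra hx'
  simp only [mem_ofPred_eq, not_lt] at hx hx'
  have h1 := hF.add_inner_gradient_le hFd x x'
  have h2 := hG.add_inner_gradient_le hGd x' x
  rw [← neg_sub, inner_neg_right, ← hxx'] at h2
  linarith

end Translates

section Transport

variable {E : Type*} [NormedAddCommGroup E] [InnerProductSpace ℝ E] [CompleteSpace E]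
  [MeasurableSpace E] [BorelSpace E] {Φ : E → ℝ}

lemma measurableSet_differentiableAt_det_ne_zero (T : E → E) :
    MeasurableSet {x | DifferentiableAt ℝ T x ∧ (fderiv ℝ T x).det ≠ 0} := by
  refine (measurableSet_of_differentiableAt ℝ T).inter ?_
  exact (ContinuousLinearMap.continuous_det.measurable.comp (measurable_fderiv ℝ T))
    (measurableSet_singleton (0 : ℝ)).compl

variable [FiniteDimensional ℝ E] (μ : Measure E) [μ.IsAddHaarMeasure]

/-- The a.e. Monge–Ampère inequality satisfied by a convex potential transporting `f dμ` to
`g dμ`; the Hessian determinant does not vanish `f dμ`-almost everywhere. -/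
lemma ConvexOn.ae_le_det_mul_of_map_gradient (hconv : ConvexOn ℝ univ Φ)
    (hdiff : Differentiable ℝ Φ) {f g : E → ℝ≥0∞} (hf : Measurable f)
    (hpush : (μ.withDensity f).map (gradient Φ) = μ.withDensity g) :
    ∀ᵐ x ∂μ, f x ≤ ENNReal.ofReal |(fderiv ℝ (gradient Φ) x).det| * g (gradient Φ x) := by
  set T := gradient Φ with hT
  have hTm : AEMeasurable T (μ.withDensity f) := (hconv.continuous_gradient hdiff).aemeasurable
  set D := {x | DifferentiableAt ℝ T x ∧ (fderiv ℝ T x).det ≠ 0} with hD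
  have hDm : MeasurableSet D := measurableSet_differentiableAt_det_ne_zero T
  have himage (s : Set E) : μ.withDensity f s ≤ μ.withDensity g (T '' s) := by
    rw [← hpush]
    exact (measure_mono (subset_preimage_image T s)).trans (Measure.le_map_apply hTm _)
  have hDc : μ.withDensity f Dᶜ = 0 := by
    have h1 : μ.withDensity f {x | ¬ DifferentiableAt ℝ T x} = 0 :=
      withDensity_absolutelyContinuous μ f (hconv.ae_differentiableAt_gradient μ hdiff)
    have h2 : μ.withDensity f {x | DifferentiableAt ℝ T x ∧ (fderiv ℝ T x).det = 0} = 0 := by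
      refine le_antisymm ((himage _).trans (le_of_eq ?_)) zero_le
      exact withDensity_absolutelyContinuous μ g
        (addHaar_image_eq_zero_of_det_fderivWithin_eq_zero μ
          (fun z hz => hz.1.hasFDerivAt.hasFDerivWithinAt) fun z hz => hz.2)
    refine measure_mono_null (fun x hx => ?_) (measure_union_null h1 h2)
    by_cases h : DifferentiableAt ℝ T x
    · exact Or.inr ⟨h, by_contra fun h' => hx ⟨h, h'⟩⟩
    · exact Or.inl h
  refine ae_le_of_forall_setLIntegral_le_of_sigmaFinite hf fun s hs _ => ?_
  calc ∫⁻ x in s, f x ∂μ = μ.withDensity f s := (withDensity_apply f hs).symm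
    _ ≤ μ.withDensity f (s ∩ D) + μ.withDensity f (s \ D) := measure_le_inter_add_sdiff _ _ _
    _ = μ.withDensity f (s ∩ D) := by
        rw [measure_mono_null (s := s \ D) (fun x hx => hx.2) hDc, add_zero]
    _ ≤ μ.withDensity g (T '' (s ∩ D)) := himage _
    _ = ∫⁻ x in s ∩ D, ENNReal.ofReal |(fderiv ℝ T x).det| * g (T x) ∂μ := by
        rw [withDensity_apply' g, lintegral_image_eq_lintegral_abs_det_fderiv_mul μ (hs.inter hDm)
          (fun x hx => hx.2.1.hasFDerivAt.hasFDerivWithinAt)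
          ((hconv.injOn_gradient hdiff).mono inter_subset_right)]
    _ ≤ ∫⁻ x in s, ENNReal.ofReal |(fderiv ℝ T x).det| * g (T x) ∂μ :=
        lintegral_mono_set inter_subset_left

lemma exp_sub_le_of_ofReal_exp_neg_le {v w d : ℝ}
    (h : ENNReal.ofReal (Real.exp (-v)) ≤ ENNReal.ofReal |d| * ENNReal.ofReal (Real.exp (-w))) :
    Real.exp (w - v) ≤ |d| := by
  rw [← ENNReal.ofReal_mul (abs_nonneg d), ENNReal.ofReal_le_ofReal_iff (by positivity)] at h
  calc Real.exp (w - v) = Real.exp (-v) * Real.exp w := by rw [← Real.exp_add]; congr 1; ring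
    _ ≤ |d| * Real.exp (-w) * Real.exp w := by gcongr
    _ = |d| := by rw [mul_assoc, ← Real.exp_add, neg_add_cancel, Real.exp_zero, mul_one]

/-- The comparison argument behind the contraction theorem: the region where the second
difference of the potential exceeds `M` is empty as soon as the gradient increments are large
there. -/
theorem ConvexOn.second_difference_le_of_map_gradient {V W : E → ℝ} (hV : Continuous V)
    (hW : Continuous W) {c C M : ℝ} {t : E}
    (hVt : ∀ x, V (x + t) + V (x - t) - 2 * V x ≤ C * ‖t‖ ^ 2)
    (hWm : ∀ p q, W ((1 / 2 : ℝ) • (p + q)) ≤ (W p + W q) / 2 - c / 8 * ‖p - q‖ ^ 2)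
    (hfin : IsFiniteMeasure (μ.withDensity fun x => ENNReal.ofReal (Real.exp (-V x))))
    (hconv : ConvexOn ℝ univ Φ) (hdiff : Differentiable ℝ Φ)
    (hpush : (μ.withDensity fun x => ENNReal.ofReal (Real.exp (-V x))).map (gradient Φ) =
      μ.withDensity fun x => ENNReal.ofReal (Real.exp (-W x)))
    (hU : ∀ x, M < Φ (x + t) + Φ (x - t) - 2 * Φ x →
      C * ‖t‖ ^ 2 < c / 4 * ‖gradient Φ (x + t) - gradient Φ (x - t)‖ ^ 2) (x : E) :
    Φ (x + t) + Φ (x - t) - 2 * Φ x ≤ M := by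
  set F : E → ℝ := fun x => (1 / 2 : ℝ) * (Φ (x + t) + Φ (x - t)) with hFdef
  set G : E → ℝ := fun x => Φ x + M / 2 with hGdef
  have hF : ConvexOn ℝ univ F := hconv.midpoint_translates t
  have hgF (x : E) := hasGradientAt_midpoint_translates hdiff t x
  have hFd : Differentiable ℝ F := fun x => (hgF x).differentiableAt
  have hFgrad : gradient F =
      fun x => (1 / 2 : ℝ) • (gradient Φ (x + t) + gradient Φ (x - t)) := gradient_eq hgF
  have hG : ConvexOn ℝ univ G := hconv.add_const _
  have hGd : Differentiable ℝ G := hdiff.add_const _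
  have hGgrad : gradient G = gradient Φ := by
    funext x; simp [gradient, hGdef]
  set U := {x | G x < F x} with hUdef
  have hUo : IsOpen U := isOpen_lt hGd.continuous hFd.continuous
  set D := {x | DifferentiableAt ℝ (gradient F) x ∧ (fderiv ℝ (gradient F) x).det ≠ 0} with hD
  have hUDm : MeasurableSet (U ∩ D) :=
    hUo.measurableSet.inter (measurableSet_differentiableAt_det_ne_zero _)
  set f : E → ℝ≥0∞ := fun x => ENNReal.ofReal (Real.exp (-V x)) with hf
  set g : E → ℝ≥0∞ := fun x => ENNReal.ofReal (Real.exp (-W x)) with hg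
  have hfm : Measurable f := by fun_prop
  have hgm : Measurable g := by fun_prop
  have hMA : ∀ᵐ x ∂μ, DifferentiableAt ℝ (gradient Φ) x ∧
      f x ≤ ENNReal.ofReal |(fderiv ℝ (gradient Φ) x).det| * g (gradient Φ x) :=
    (hconv.ae_differentiableAt_gradient μ hdiff).and
      (hconv.ae_le_det_mul_of_map_gradient μ hdiff hfm hpush)
  have hkey : ∀ᵐ x ∂μ, x ∈ U → x ∈ D ∧
      f x < ENNReal.ofReal |(fderiv ℝ (gradient F) x).det| * g (gradient F x) := by
    filter_upwards [(measurePreserving_add_right μ t).quasiMeasurePreserving.ae hMA,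
      (measurePreserving_sub_right μ t).quasiMeasurePreserving.ae hMA]
      with x ⟨hd1, hma1⟩ ⟨hd2, hma2⟩ hxU
    set A := fderiv ℝ (gradient Φ) (x + t) with hA
    set B := fderiv ℝ (gradient Φ) (x - t) with hB
    have hder : HasFDerivAt (gradient F) ((1 / 2 : ℝ) • (A + B)) x := by
      rw [hFgrad]
      exact (((hasFDerivAt_comp_add_right t).2 hd1.hasFDerivAt).add
        ((hasFDerivAt_comp_sub t).2 hd2.hasFDerivAt)).const_smul _
    have hAV := exp_sub_le_of_ofReal_exp_neg_le hma1
    have hBV := exp_sub_le_of_ofReal_exp_neg_le hma2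
    obtain ⟨hA0, hB0, hAB⟩ := A.det_mul_det_le_det_midpoint_sq
      (isSymmetric_fderiv_gradient hdiff hd1) (isSymmetric_fderiv_gradient hdiff hd2)
      (hconv.inner_fderiv_gradient_nonneg hdiff hd1) (hconv.inner_fderiv_gradient_nonneg hdiff hd2)
      (abs_pos.1 ((Real.exp_pos _).trans_le hAV)) (abs_pos.1 ((Real.exp_pos _).trans_le hBV))
    rw [abs_of_pos hA0] at hAV
    rw [abs_of_pos hB0] at hBV
    rw [hD, mem_ofPred_eq, hder.fderiv]
    set d := ((1 / 2 : ℝ) • (A + B)).det with hd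
    refine ⟨⟨hder.differentiableAt, fun h0 => ?_⟩, ?_⟩
    · rw [h0] at hAB
      linarith [mul_pos hA0 hB0]
    have hexp : Real.exp ((W (gradient Φ (x + t)) + W (gradient Φ (x - t)) - V (x + t) -
        V (x - t)) / 2) ≤ |d| := by
      refine le_of_sq_le_sq ?_ (abs_nonneg d)
      rw [sq_abs]
      refine le_trans (le_of_eq ?_) ((mul_le_mul hAV hBV (Real.exp_nonneg _) hA0.le).trans hAB)
      rw [← Real.exp_nat_mul, ← Real.exp_add]
      congr 1
      push_cast
      ring
    have h1 := hWm (gradient Φ (x + t)) (gradient Φ (x - t))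
    have h2 := hU x (by simp only [hUdef, hFdef, hGdef, mem_ofPred_eq] at hxU; linarith)
    have h3 := hVt x
    rw [hFgrad, hf, hg, ← ENNReal.ofReal_mul (abs_nonneg d)]
    refine (ENNReal.ofReal_lt_ofReal_iff_of_nonneg (Real.exp_nonneg _)).2 ?_
    refine lt_of_lt_of_le ?_ (mul_le_mul_of_nonneg_right hexp (Real.exp_nonneg _))
    rw [← Real.exp_add, Real.exp_lt_exp]
    linarith
  have hUnull : μ U = 0 := by
    by_contra hU0
    have hUD : μ (U ∩ D) = μ U := by
      refine measure_congr ?_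
      filter_upwards [hkey] with x hx
      exact propext ⟨fun h => h.1, fun h => ⟨h, (hx h).1⟩⟩
    have hlt : ∫⁻ x in U ∩ D, f x ∂μ <
        ∫⁻ x in U ∩ D, ENNReal.ofReal |(fderiv ℝ (gradient F) x).det| * g (gradient F x) ∂μ := by
      refine setLIntegral_strict_mono hUDm (hUD ▸ hU0) ?_ ?_ ?_
      · have h1 : Measurable (gradient F) := (hF.continuous_gradient hFd).measurable
        have h2 := ContinuousLinearMap.continuous_det.measurable.comp
          (measurable_fderiv ℝ (gradient F))
        exact (ENNReal.measurable_ofReal.comp (continuous_abs.measurable.comp h2)).mul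
          (hgm.comp h1)
      · rw [← withDensity_apply f hUDm]
        exact measure_ne_top _ _
      · filter_upwards [hkey] with x hx hxU using (hx hxU.1).2
    have hinj : InjOn (gradient F) (U ∩ D) := (hF.injOn_gradient hFd).mono inter_subset_right
    have hder : ∀ x ∈ U ∩ D,
        HasFDerivWithinAt (gradient F) (fderiv ℝ (gradient F) x) (U ∩ D) x :=
      fun x hx => hx.2.1.hasFDerivAt.hasFDerivWithinAt
    rw [← lintegral_image_eq_lintegral_abs_det_fderiv_mul μ hUDm hder hinj,
      ← withDensity_apply f hUDm, ← withDensity_apply' g, ← hpush,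
      Measure.map_apply (hconv.continuous_gradient hdiff).measurable
        (measurable_image_of_fderivWithin hUDm hder hinj)] at hlt
    refine absurd hlt (not_lt.2 ?_)
    calc _ ≤ μ.withDensity f U := by
          refine measure_mono (Subset.trans ?_ (gradient_preimage_image_subset hF hFd hG hGd))
          rw [hGgrad]
          exact preimage_mono (image_mono inter_subset_left)
      _ = μ.withDensity f (U ∩ D) := by
          refine measure_congr ((withDensity_absolutelyContinuous μ f).ae_le ?_)
          filter_upwards [hkey] with x hx
          exact propext ⟨fun h => ⟨h, (hx h).1⟩, fun h => h.1⟩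
  have hUe : U = ∅ := (hUo.measure_eq_zero_iff μ).1 hUnull
  by_contra! hx
  have : x ∈ U := by
    simp only [hUdef, mem_ofPred_eq, hFdef, hGdef]
    linarith
  simp [hUe] at this

end Transport

section SecondDifference

variable {E : Type*} [NormedAddCommGroup E]

/-- A lower bound on the Hessian bounds second differences from below. -/
lemma le_second_difference_of_le_iteratedFDeriv [NormedSpace ℝ E] {f : E → ℝ}
    (hf : ContDiff ℝ 2 f) {m : ℝ} (h : ∀ x v, m * ‖v‖ ^ 2 ≤ iteratedFDeriv ℝ 2 f x ![v, v])
    (x t : E) : m * ‖t‖ ^ 2 ≤ f (x + t) + f (x - t) - 2 * f x := by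
  have hline (s : ℝ) : HasDerivAt (fun s : ℝ => x + s • t) t s := by
    simpa using ((hasDerivAt_id s).smul_const t).const_add x
  have h1 (s : ℝ) : HasDerivAt (fun s : ℝ => f (x + s • t)) (fderiv ℝ f (x + s • t) t) s :=
    ((hf.differentiable (by norm_num)) _).hasFDerivAt.comp_hasDerivAt s (hline s)
  have h2 (s : ℝ) : HasDerivAt (fun s : ℝ => fderiv ℝ f (x + s • t) t)
      (iteratedFDeriv ℝ 2 f (x + s • t) ![t, t]) s := by
    have hd : Differentiable ℝ (fderiv ℝ f) :=
      (hf.fderiv_right (m := 1) (by norm_num)).differentiable (by norm_num)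
    have h3 : HasDerivAt (fun s : ℝ => fderiv ℝ f (x + s • t))
        (fderiv ℝ (fderiv ℝ f) (x + s • t) t) s :=
      (hd (x + s • t)).hasFDerivAt.comp_hasDerivAt s (hline s)
    simpa [iteratedFDeriv_two_apply] using h3.clm_apply (hasDerivAt_const s t)
  set k : ℝ → ℝ := fun s => f (x + s • t) - m * ‖t‖ ^ 2 / 2 * s ^ 2 with hk
  have hk1 (s : ℝ) : HasDerivAt k (fderiv ℝ f (x + s • t) t - m * ‖t‖ ^ 2 * s) s := by
    convert! (h1 s).sub ((hasDerivAt_pow 2 s).const_mul (m * ‖t‖ ^ 2 / 2)) using 1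
    push_cast
    ring
  have hk2 (s : ℝ) : HasDerivAt (fun s => fderiv ℝ f (x + s • t) t - m * ‖t‖ ^ 2 * s)
      (iteratedFDeriv ℝ 2 f (x + s • t) ![t, t] - m * ‖t‖ ^ 2) s := by
    simpa using! (h2 s).sub ((hasDerivAt_id s).const_mul (m * ‖t‖ ^ 2))
  have hconv : ConvexOn ℝ univ k := by
    refine convexOn_of_hasDerivWithinAt2_nonneg convex_univ
      (fun s _ => (hk1 s).continuousAt.continuousWithinAt)
      (fun s _ => (hk1 s).hasDerivWithinAt) (fun s _ => (hk2 s).hasDerivWithinAt) fun s _ => ?_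
    linarith [h (x + s • t) t]
  have := hconv.2 (mem_univ 1) (mem_univ (-1)) (show (0 : ℝ) ≤ 1 / 2 by norm_num)
    (show (0 : ℝ) ≤ 1 / 2 by norm_num) (by norm_num)
  simp [hk, ← sub_eq_add_neg] at this
  linarith

variable [InnerProductSpace ℝ E] [CompleteSpace E] {Φ : E → ℝ}

lemma ConvexOn.second_difference_le_inner (hconv : ConvexOn ℝ univ Φ)
    (hdiff : Differentiable ℝ Φ) (x t : E) :
    Φ (x + t) + Φ (x - t) - 2 * Φ x ≤ ⟪gradient Φ (x + t) - gradient Φ (x - t), t⟫ := by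
  have h1 := hconv.add_inner_gradient_le hdiff (x + t) x
  have h2 := hconv.add_inner_gradient_le hdiff (x - t) x
  rw [sub_add_cancel_left, inner_neg_right] at h1
  rw [sub_sub_self] at h2
  rw [inner_sub_left]
  linarith

lemma ConvexOn.second_difference_le_smul_add_inner (hconv : ConvexOn ℝ univ Φ)
    (hdiff : Differentiable ℝ Φ) (x t : E) (s : ℝ) :
    Φ (x + t) + Φ (x - t) - 2 * Φ x ≤ Φ (x + s • t) + Φ (x - s • t) - 2 * Φ x +
      (1 - s) * ⟪gradient Φ (x + t) - gradient Φ (x - t), t⟫ := by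
  have h1 := hconv.add_inner_gradient_le hdiff (x + t) (x + s • t)
  have h2 := hconv.add_inner_gradient_le hdiff (x - t) (x - s • t)
  rw [show x + s • t - (x + t) = -((1 - s) • t) by rw [sub_smul, one_smul]; abel,
    inner_neg_right, inner_smul_right] at h1
  rw [show x - s • t - (x - t) = (1 - s) • t by rw [sub_smul, one_smul]; abel,
    inner_smul_right] at h2
  rw [inner_sub_left]
  linarith

/-- Self-improvement of a quadratic bound on second differences, given a comparison principle
that turns largeness of gradient increments into a bound on second differences. -/
lemma ConvexOn.second_difference_le_of_comparison (hconv : ConvexOn ℝ univ Φ)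
    (hdiff : Differentiable ℝ Φ) {K : ℝ} (hK : 0 < K)
    (hcomp : ∀ (t : E) (M : ℝ), (∀ x, M < Φ (x + t) + Φ (x - t) - 2 * Φ x →
      2 * K * ‖t‖ < ‖gradient Φ (x + t) - gradient Φ (x - t)‖) →
      ∀ x, Φ (x + t) + Φ (x - t) - 2 * Φ x ≤ M) (x t : E) :
    Φ (x + t) + Φ (x - t) - 2 * Φ x ≤ K * ‖t‖ ^ 2 := by
  have hnorm {p t : E} (h : 2 * K * ‖t‖ ^ 2 < ⟪p, t⟫) : 2 * K * ‖t‖ < ‖p‖ := by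
    refine lt_of_mul_lt_mul_right (lt_of_lt_of_le ?_ (real_inner_le_norm p t)) (norm_nonneg t)
    linarith
  set S : Set ℝ := {L | K ≤ L ∧ ∀ x t, Φ (x + t) + Φ (x - t) - 2 * Φ x ≤ L * ‖t‖ ^ 2} with hS
  have hne : S.Nonempty := ⟨2 * K, by linarith, fun x t => hcomp t _ (fun y hy =>
    hnorm (hy.trans_le (hconv.second_difference_le_inner hdiff y t))) x⟩
  have hclosed : IsClosed S := by
    have h1 : S = Ici K ∩
        ⋂ x, ⋂ t, {L : ℝ | Φ (x + t) + Φ (x - t) - 2 * Φ x ≤ L * ‖t‖ ^ 2} := by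
      ext; simp [hS]
    rw [h1]
    refine isClosed_Ici.inter ?_
    exact isClosed_iInter fun x => isClosed_iInter fun t =>
      isClosed_le continuous_const (continuous_id.mul continuous_const)
  have hbdd : BddBelow S := ⟨K, fun L hL => hL.1⟩
  have hmem := hclosed.csInf_mem hne hbdd
  set L := sInf S
  obtain ⟨hKL, hL⟩ := hmem
  have hL0 : 0 < L := hK.trans_le hKL
  have himp : 2 * K - K ^ 2 / L ∈ S := by
    have hdiv : K ^ 2 / L ≤ K := by
      rw [div_le_iff₀ hL0]; nlinarith
    refine ⟨by linarith, fun x t => hcomp t _ (fun y hy => hnorm ?_) x⟩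
    have h1 := hconv.second_difference_le_smul_add_inner hdiff y t (K / L)
    have h2 := hL y ((K / L) • t)
    have h3 : L * ‖(K / L) • t‖ ^ 2 = K ^ 2 / L * ‖t‖ ^ 2 := by
      rw [norm_smul, mul_pow, Real.norm_eq_abs, sq_abs]; field_simp
    have h4 : (1 - K / L) * (2 * K * ‖t‖ ^ 2) =
        (2 * K - K ^ 2 / L) * ‖t‖ ^ 2 - K ^ 2 / L * ‖t‖ ^ 2 := by field_simp; ring
    refine lt_of_mul_lt_mul_left ?_ (sub_nonneg.2 ((div_le_one hL0).2 hKL))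
    linarith
  have hle : L ≤ 2 * K - K ^ 2 / L := csInf_le hbdd himp
  have hLK : L = K := by
    have h1 : L * L ≤ (2 * K - K ^ 2 / L) * L := mul_le_mul_of_nonneg_right hle hL0.le
    have h2 : (2 * K - K ^ 2 / L) * L = 2 * K * L - K ^ 2 := by field_simp
    have h3 : (L - K) ^ 2 = 0 := le_antisymm (by linarith) (sq_nonneg _)
    exact sub_eq_zero.1 (pow_eq_zero_iff two_ne_zero |>.1 h3)
  exact hLK ▸ hL x t

/-- A bound on second differences gives a quadratic upper bound around each point. -/
lemma le_add_inner_gradient_add_of_second_difference_le (hdiff : Differentiable ℝ Φ) {K : ℝ}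
    (h : ∀ x t, Φ (x + t) + Φ (x - t) - 2 * Φ x ≤ K * ‖t‖ ^ 2) (x t : E) :
    Φ (x + t) ≤ Φ x + ⟪gradient Φ x, t⟫ + K / 2 * ‖t‖ ^ 2 := by
  set ρ : ℝ → ℝ := fun s => Φ (x + s • t) - Φ x - s * ⟪gradient Φ x, t⟫ - K / 2 * ‖t‖ ^ 2 * s ^ 2
    with hρ
  have hhalf (s : ℝ) : ρ s ≤ 2 * ρ (s * (1 / 2)) := by
    have h1 := h (x + (s * (1 / 2)) • t) ((s * (1 / 2)) • t)
    rw [add_assoc, ← add_smul, add_sub_cancel_right, norm_smul, mul_pow, Real.norm_eq_abs, sq_abs,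
      show s * (1 / 2) + s * (1 / 2) = s by ring] at h1
    simp only [hρ]
    linarith
  have hiter (n : ℕ) : ρ 1 ≤ ((1 / 2 : ℝ) ^ n)⁻¹ * ρ ((1 / 2) ^ n) := by
    induction n with
    | zero => simp
    | succ n ih =>
      refine ih.trans ?_
      rw [pow_succ, mul_inv, mul_assoc]
      simpa using mul_le_mul_of_nonneg_left (hhalf ((1 / 2) ^ n))
        (show 0 ≤ ((1 / 2 : ℝ) ^ n)⁻¹ by positivity)
  have hder : HasDerivAt ρ 0 0 := by
    have h1 : HasDerivAt (fun s : ℝ => Φ (x + s • t)) ⟪gradient Φ x, t⟫ 0 := by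
      have h2 : HasDerivAt (fun s : ℝ => x + s • t) t 0 := by
        simpa using ((hasDerivAt_id (0 : ℝ)).smul_const t).const_add x
      have h3 : HasFDerivAt Φ (fderiv ℝ Φ x) (x + (0 : ℝ) • t) := by
        simpa using (hdiff x).hasFDerivAt
      rw [inner_gradient_left]
      exact h3.comp_hasDerivAt (0 : ℝ) h2
    convert! ((h1.sub_const (Φ x)).sub ((hasDerivAt_id (0 : ℝ)).mul_const
      ⟪gradient Φ x, t⟫)).sub ((hasDerivAt_pow 2 (0 : ℝ)).const_mul (K / 2 * ‖t‖ ^ 2)) using 1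
    simp
  have hlim : Tendsto (fun n : ℕ => ((1 / 2 : ℝ) ^ n)⁻¹ * ρ ((1 / 2) ^ n)) atTop (𝓝 0) := by
    have h1 : Tendsto (fun n : ℕ => (1 / 2 : ℝ) ^ n) atTop (𝓝[≠] 0) :=
      tendsto_nhdsWithin_iff.2 ⟨tendsto_pow_atTop_nhds_zero_of_lt_one (by norm_num) (by norm_num),
        Eventually.of_forall fun n => pow_ne_zero n (by norm_num)⟩
    have h2 : ρ 0 = 0 := by simp [hρ]
    simpa [Function.comp_def, h2] using hder.tendsto_slope_zero.comp h1
  have := ge_of_tendsto' hlim hiter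
  simp only [hρ, one_smul] at this
  linarith

/-- The **Baillon–Haddad** argument: a convex function with a quadratic upper bound around each
point has Lipschitz gradient. -/
lemma ConvexOn.norm_gradient_sub_le (hconv : ConvexOn ℝ univ Φ) (hdiff : Differentiable ℝ Φ)
    {K : ℝ} (hK : 0 < K)
    (h : ∀ x t, Φ (x + t) ≤ Φ x + ⟪gradient Φ x, t⟫ + K / 2 * ‖t‖ ^ 2) (x y : E) :
    ‖gradient Φ x - gradient Φ y‖ ≤ K * ‖x - y‖ := by
  have key (x y : E) : Φ x + ⟪gradient Φ x, y - x⟫ +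
      ‖gradient Φ x - gradient Φ y‖ ^ 2 / (2 * K) ≤ Φ y := by
    set p := gradient Φ x - gradient Φ y with hp
    have h1 := h y (K⁻¹ • p)
    have h2 := hconv.add_inner_gradient_le hdiff x (y + K⁻¹ • p)
    rw [inner_smul_right, norm_smul, norm_inv, Real.norm_of_nonneg hK.le] at h1
    rw [add_sub_right_comm, inner_add_right, inner_smul_right] at h2
    have h3 : K⁻¹ * ⟪gradient Φ x, p⟫ = K⁻¹ * ⟪gradient Φ y, p⟫ + K⁻¹ * ‖p‖ ^ 2 := by
      rw [← mul_add, ← real_inner_self_eq_norm_sq, ← inner_add_left, hp, add_sub_cancel]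
    have h4 : K / 2 * (K⁻¹ * ‖p‖) ^ 2 = K⁻¹ * ‖p‖ ^ 2 / 2 := by field_simp
    have h5 : ‖p‖ ^ 2 / (2 * K) = K⁻¹ * ‖p‖ ^ 2 / 2 := by field_simp
    linarith
  have h1 := key x y
  have h2 := key y x
  rw [norm_sub_rev (gradient Φ y)] at h2
  have h3 : ⟪gradient Φ x, y - x⟫ + ⟪gradient Φ y, x - y⟫ =
      -⟪gradient Φ x - gradient Φ y, x - y⟫ := by
    rw [← neg_sub x y, inner_neg_right, inner_sub_left]; ring
  have h4 := real_inner_le_norm (gradient Φ x - gradient Φ y) (x - y)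
  have h5 : ‖gradient Φ x - gradient Φ y‖ ^ 2 =
      K * (2 * (‖gradient Φ x - gradient Φ y‖ ^ 2 / (2 * K))) := by field_simp
  have h6 : ‖gradient Φ x - gradient Φ y‖ ^ 2 ≤
      K * (‖gradient Φ x - gradient Φ y‖ * ‖x - y‖) := by
    rw [h5]
    exact mul_le_mul_of_nonneg_left (by linarith) hK.le
  rcases (norm_nonneg (gradient Φ x - gradient Φ y)).eq_or_lt with h0 | h0
  · rw [← h0]; positivity
  · refine le_of_mul_le_mul_left (h6.trans_eq' ?_ |>.trans_eq ?_) h0 <;> ring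

end SecondDifference

end Auxiliary

/-- **Caffarelli's contraction theorem.** The optimal transportation map between
`e^{-V} dx` and `e^{-W} dx` with `D²V ≤ C·Id` and `D²W ≥ c·Id` is `√(C/c)`-Lipschitz. -/
theorem caffarelli_contraction {n : ℕ} (V W : EuclideanSpace ℝ (Fin n) → ℝ)
    (hV : ContDiff ℝ 2 V) (hW : ContDiff ℝ 2 W)
    (c C : ℝ) (hc : 0 < c) (hC : 0 < C)
    (hVC : ∀ x v : EuclideanSpace ℝ (Fin n), iteratedFDeriv ℝ 2 V x ![v, v] ≤ C * ‖v‖ ^ 2)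
    (hWc : ∀ x v : EuclideanSpace ℝ (Fin n), c * ‖v‖ ^ 2 ≤ iteratedFDeriv ℝ 2 W x ![v, v])
    (hVprob : IsProbabilityMeasure
      (volume.withDensity fun x => ENNReal.ofReal (Real.exp (-V x))))
    (hWprob : IsProbabilityMeasure
      (volume.withDensity fun x => ENNReal.ofReal (Real.exp (-W x))))
    (Φ : EuclideanSpace ℝ (Fin n) → ℝ)
    (hconv : ConvexOn ℝ Set.univ Φ) (hdiff : Differentiable ℝ Φ)
    (hpush : (volume.withDensity fun x => ENNReal.ofReal (Real.exp (-V x))).map (gradient Φ) =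
      volume.withDensity fun x => ENNReal.ofReal (Real.exp (-W x)))
    (hopt : ∀ π : Measure (EuclideanSpace ℝ (Fin n) × EuclideanSpace ℝ (Fin n)),
      IsCoupling (volume.withDensity fun x => ENNReal.ofReal (Real.exp (-V x)))
        (volume.withDensity fun x => ENNReal.ofReal (Real.exp (-W x))) π →
      (∫⁻ p, ENNReal.ofReal (‖p.1 - p.2‖ ^ 2)
          ∂((volume.withDensity fun x => ENNReal.ofReal (Real.exp (-V x))).map
            (fun x => (x, gradient Φ x)))) ≤
        ∫⁻ p, ENNReal.ofReal (‖p.1 - p.2‖ ^ 2) ∂π) :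
    ∀ x y : EuclideanSpace ℝ (Fin n),
      ‖gradient Φ x - gradient Φ y‖ ≤ Real.sqrt (C / c) * ‖x - y‖ := by
  set K := Real.sqrt (C / c) with hKdef
  have hK : 0 < K := Real.sqrt_pos.2 (by positivity)
  have hcK : c * K ^ 2 = C := by
    rw [hKdef, Real.sq_sqrt (by positivity)]; field_simp
  have hVt (t x : EuclideanSpace ℝ (Fin n)) :
      V (x + t) + V (x - t) - 2 * V x ≤ C * ‖t‖ ^ 2 := by
    have h := le_second_difference_of_le_iteratedFDeriv hV.neg (m := -C) (fun x v => by
      have h1 := hVC x v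
      have h2 : iteratedFDeriv ℝ 2 (fun x => -V x) x = -iteratedFDeriv ℝ 2 V x :=
        iteratedFDeriv_neg_apply
      rw [h2, neg_apply]
      linarith) x t
    linarith
  have hWm (p q : EuclideanSpace ℝ (Fin n)) :
      W ((1 / 2 : ℝ) • (p + q)) ≤ (W p + W q) / 2 - c / 8 * ‖p - q‖ ^ 2 := by
    have h := le_second_difference_of_le_iteratedFDeriv hW hWc ((1 / 2 : ℝ) • (p + q))
      ((1 / 2 : ℝ) • (p - q))
    rw [show (1 / 2 : ℝ) • (p + q) + (1 / 2 : ℝ) • (p - q) = p by module,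
      show (1 / 2 : ℝ) • (p + q) - (1 / 2 : ℝ) • (p - q) = q by module, norm_smul, mul_pow] at h
    norm_num at h
    norm_num
    linarith
  refine hconv.norm_gradient_sub_le hdiff hK
    (le_add_inner_gradient_add_of_second_difference_le hdiff
      (hconv.second_difference_le_of_comparison hdiff hK fun t M hM =>
        hconv.second_difference_le_of_map_gradient volume hV.continuous hW.continuous (hVt t) hWm
          inferInstance hdiff hpush fun x hx => ?_))
  have h1 := pow_lt_pow_left₀ (hM x hx) (by positivity) two_ne_zero
  have h2 := mul_lt_mul_of_pos_left h1 (show 0 < c / 4 by positivity)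
  refine lt_of_eq_of_lt ?_ h2
  rw [← hcK]
  ring
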